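/- arXiv:1607.08470 — 2 statements merged into one kernel-verified Lean document; each statement's English description precedes it below -/
import Mathlib

section
/- Let m be a real number with m > p(p+3)/(p−1). Then there exists a unique σ* ∈ (p−1, ∞) such that α(σ*) = m, and moreover σ* = σ_c(m, p), where σ_c(m, p) = [((p−1)m − p)² + p²(p−2) − p²(p−1)m + 2p²√((p−1)(m−1))] / ((m−p)((p−1)m − p(p+3))). -/
open MeasureTheory Real Set Metric Filter
open scoped ENNReal NNReal RealInnerProductSpace

noncomputable section

/-- Euclidean space `ℝ^m`. -/
abbrev Em (m : ℕ) := EuclideanSpace ℝ (Fin m)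

/-- A Lipschitz function with compact support. -/
def LipCS {m : ℕ} (φ : Em m → ℝ) : Prop :=
  (∃ L : ℝ≥0, LipschitzWith L φ) ∧ HasCompactSupport φ

/-- `u` is a weak solution of `-Δ_p u = V |u|^(σ-1) u` on `ℝ^m`:
`u` is `C¹`, `|∇u|^p` and `V |u|^(σ+1)` are locally integrable, and the weak
formulation holds against every Lipschitz test function with compact support. -/
def IsWeakSol {m : ℕ} (p σ : ℝ) (V u : Em m → ℝ) : Prop :=
  ContDiff ℝ 1 u ∧
  LocallyIntegrable (fun x => ‖gradient u x‖ ^ p) volume ∧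
  LocallyIntegrable (fun x => V x * |u x| ^ (σ + 1)) volume ∧
  ∀ φ : Em m → ℝ, LipCS φ →
    (∫ x, ‖gradient u x‖ ^ (p - 2) * ⟪gradient u x, gradient φ x⟫) =
      ∫ x, V x * |u x| ^ (σ - 1) * u x * φ x

/-- Stability of a weak solution `u`. -/
def IsStable {m : ℕ} (p σ : ℝ) (V u : Em m → ℝ) : Prop :=
  ∀ φ : Em m → ℝ, LipCS φ →
    σ * ∫ x, V x * |u x| ^ (σ - 1) * φ x ^ 2 ≤
      (∫ x, ‖gradient u x‖ ^ (p - 2) * ‖gradient φ x‖ ^ 2) +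
        (p - 2) * ∫ x, ‖gradient u x‖ ^ (p - 4) * ⟪gradient u x, gradient φ x⟫ ^ 2

/-- `γ̄ = (2σ - p + 1 + 2√(σ(σ - p + 1)))/(p - 1)`. -/
def gammaBar (p σ : ℝ) : ℝ := (2 * σ - p + 1 + 2 * Real.sqrt (σ * (σ - p + 1))) / (p - 1)

/-- `α = p (σ + γ̄)/(σ - p + 1)`. -/
def alphaC (p σ : ℝ) : ℝ := p * (σ + gammaBar p σ) / (σ - p + 1)

/-- `β = (γ̄ + p - 1)/(σ - p + 1)`. -/
def betaC (p σ : ℝ) : ℝ := (gammaBar p σ + p - 1) / (σ - p + 1)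

/-- The critical exponent `σ_c(m, p)`. -/
def sigmaC (mr p : ℝ) : ℝ :=
  (((p - 1) * mr - p) ^ 2 + p ^ 2 * (p - 2) - p ^ 2 * (p - 1) * mr +
      2 * p ^ 2 * Real.sqrt ((p - 1) * (mr - 1))) /
    ((mr - p) * ((p - 1) * mr - p * (p + 3)))

/-- Condition (HP1). -/
def HP1 {m : ℕ} (p σ : ℝ) (V : Em m → ℝ) : Prop :=
  ∃ C C₀ R₀ ε₀ : ℝ, 0 < C ∧ 0 < C₀ ∧ 0 < R₀ ∧ 0 < ε₀ ∧
    ∀ ε ∈ Set.Ioo (0 : ℝ) ε₀, ∀ R > R₀,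
      (∫⁻ x in Metric.ball (0 : Em m) R \ Metric.ball (0 : Em m) (R / 2),
          ENNReal.ofReal (V x ^ (-(betaC p σ) + ε))) ≤
        ENNReal.ofReal (C * R ^ (alphaC p σ + C₀ * ε) * (Real.log R)⁻¹)

/-- Condition (HP2). -/
def HP2 {m : ℕ} (p σ : ℝ) (V : Em m → ℝ) : Prop :=
  ∃ C C₀ R₀ ε₀ θ b : ℝ, 0 < C ∧ 0 < C₀ ∧ 0 < R₀ ∧ 0 < ε₀ ∧ 0 < θ ∧
    b < -1 + θ / (σ - p + 1) ∧
    ∀ ε ∈ Set.Ioo (0 : ℝ) ε₀, ∀ R > R₀,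
      (∫⁻ x in Metric.ball (0 : Em m) R \ Metric.ball (0 : Em m) (R / 2),
          ENNReal.ofReal (V x ^ (-(betaC p σ) + ε))) ≤
        ENNReal.ofReal (C * R ^ (alphaC p σ + C₀ * ε) * Real.log R ^ b *
          Real.exp (-θ * ε * Real.log (R / 2) * Real.log (Real.log (R / 2))))

/-- Inverse of the change of variable `t = √(σ / (σ - p + 1))`, as a function of `t > 1`. -/
def sigmaOfRatio (p t : ℝ) : ℝ := (p - 1) * t ^ 2 / (t ^ 2 - 1)

theorem sigmaOfRatio_sub (p : ℝ) {t : ℝ} (ht : 1 < t) :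
    sigmaOfRatio p t - p + 1 = (p - 1) / (t ^ 2 - 1) := by
  have h : t ^ 2 - 1 ≠ 0 := by nlinarith
  unfold sigmaOfRatio
  field_simp
  ring

theorem sigmaOfRatio_gt {p t : ℝ} (hp : 1 < p) (ht : 1 < t) : p - 1 < sigmaOfRatio p t := by
  have h : 0 < (p - 1) / (t ^ 2 - 1) := div_pos (by linarith) (by nlinarith)
  linarith [sigmaOfRatio_sub p ht]

theorem exists_sigmaOfRatio_eq {p s : ℝ} (hp : 1 < p) (hs : p - 1 < s) :
    ∃ t, 1 < t ∧ sigmaOfRatio p t = s := by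
  have hd : 0 < s - p + 1 := by linarith
  have hlt : 1 < s / (s - p + 1) := by
    rw [one_lt_div hd]
    linarith
  refine ⟨√(s / (s - p + 1)), Real.lt_sqrt_of_sq_lt (by simpa using hlt), ?_⟩
  have hne : s / (s - p + 1) - 1 ≠ 0 := by linarith
  rw [sigmaOfRatio, Real.sq_sqrt (by linarith), div_eq_iff hne]
  field_simp
  ring

theorem alphaC_sigmaOfRatio {p t : ℝ} (hp : 1 < p) (ht : 1 < t) :
    alphaC p (sigmaOfRatio p t) = p * (t ^ 2 + (t + 1) ^ 2 / (p - 1)) := by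
  have hq : 0 < p - 1 := by linarith
  have hd : 0 < t ^ 2 - 1 := by nlinarith
  have hsqrt : √(sigmaOfRatio p t * (sigmaOfRatio p t - p + 1)) =
      (p - 1) * t / (t ^ 2 - 1) := by
    rw [sigmaOfRatio_sub p ht, Real.sqrt_eq_iff_mul_self_eq_of_pos (by positivity), sigmaOfRatio]
    field_simp
  rw [alphaC, gammaBar, hsqrt, sigmaOfRatio_sub p ht, sigmaOfRatio]
  field_simp
  ring

theorem alphaC_sigmaOfRatio_injOn {p : ℝ} (hp : 1 < p) :
    Set.InjOn (fun t => alphaC p (sigmaOfRatio p t)) (Set.Ioi 1) := by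
  intro t (ht : 1 < t) u (hu : 1 < u) h
  have hq : 0 < p - 1 := by linarith
  simp only [alphaC_sigmaOfRatio hp ht, alphaC_sigmaOfRatio hp hu] at h
  field_simp at h
  have hfac : (t - u) * (p * (t + u) + 2) = 0 := by linarith
  rcases mul_eq_zero.mp hfac with h | h
  · linarith
  · nlinarith

theorem lt_sqrt_of_threshold_lt {p mr : ℝ} (hp : 1 < p) (hm : p * (p + 3) / (p - 1) < mr) :
    p + 1 < √((p - 1) * (mr - 1)) := by
  rw [div_lt_iff₀ (by linarith)] at hm
  exact Real.lt_sqrt_of_sq_lt (by linarith)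

theorem sigmaC_eq_sigmaOfRatio {p mr : ℝ} (hp : 1 < p) (hm : p * (p + 3) / (p - 1) < mr) :
    sigmaC mr p = sigmaOfRatio p ((√((p - 1) * (mr - 1)) - 1) / p) := by
  have hS := lt_sqrt_of_threshold_lt hp hm
  have hq : 0 < p - 1 := by linarith
  have hsq : √((p - 1) * (mr - 1)) ^ 2 = (p - 1) * (mr - 1) :=
    Real.sq_sqrt (Real.sqrt_pos.mp (by linarith)).le
  rw [sigmaC, sigmaOfRatio]
  generalize √((p - 1) * (mr - 1)) = S at hS hsq ⊢
  obtain rfl : mr = S ^ 2 / (p - 1) + 1 := by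
    field_simp
    linarith
  have h₁ : S - 1 - p ≠ 0 := by linarith
  have h₂ : S - 1 + p ≠ 0 := by linarith
  have h₃ : S + 1 + p ≠ 0 := by linarith
  have h₄ : S + 1 - p ≠ 0 := by linarith
  have hden : (S ^ 2 / (p - 1) + 1 - p) * ((p - 1) * (S ^ 2 / (p - 1) + 1) - p * (p + 3)) =
      (S - 1 - p) * (S - 1 + p) * (S + 1 + p) * (S + 1 - p) / (p - 1) := by
    field_simp
    ring
  have hnum : ((p - 1) * (S ^ 2 / (p - 1) + 1) - p) ^ 2 + p ^ 2 * (p - 2) -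
      p ^ 2 * (p - 1) * (S ^ 2 / (p - 1) + 1) + 2 * p ^ 2 * S =
      (S - 1) ^ 2 * (S + 1 + p) * (S + 1 - p) := by
    field_simp
    ring
  have hratio : ((S - 1) / p) ^ 2 - 1 = (S - 1 - p) * (S - 1 + p) / p ^ 2 := by
    field_simp
    ring
  rw [hden, hnum, hratio]
  field_simp

theorem alphaC_sigmaC {p mr : ℝ} (hp : 1 < p) (hm : p * (p + 3) / (p - 1) < mr) :
    sigmaC mr p ∈ Set.Ioi (p - 1) ∧ alphaC p (sigmaC mr p) = mr := by
  have hS := lt_sqrt_of_threshold_lt hp hm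
  have hq : 0 < p - 1 := by linarith
  have ht : 1 < (√((p - 1) * (mr - 1)) - 1) / p := by
    rw [one_lt_div (by linarith)]
    linarith
  have hsq : √((p - 1) * (mr - 1)) ^ 2 = (p - 1) * (mr - 1) :=
    Real.sq_sqrt (Real.sqrt_pos.mp (by linarith)).le
  rw [sigmaC_eq_sigmaOfRatio hp hm]
  refine ⟨sigmaOfRatio_gt hp ht, ?_⟩
  rw [alphaC_sigmaOfRatio hp ht]
  field_simp
  linear_combination p * hsq

theorem alphaC_injOn {p : ℝ} (hp : 1 < p) : Set.InjOn (alphaC p) (Set.Ioi (p - 1)) := by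
  intro s hs s' hs' h
  obtain ⟨t, ht, rfl⟩ := exists_sigmaOfRatio_eq hp hs
  obtain ⟨u, hu, rfl⟩ := exists_sigmaOfRatio_eq hp hs'
  rw [alphaC_sigmaOfRatio_injOn hp ht hu h]

theorem alpha_critical_exponent (p : ℝ) (hp : 2 ≤ p) (mr : ℝ)
    (hm : p * (p + 3) / (p - 1) < mr) :
    (∃! s : ℝ, s ∈ Set.Ioi (p - 1) ∧ alphaC p s = mr) ∧
      sigmaC mr p ∈ Set.Ioi (p - 1) ∧ alphaC p (sigmaC mr p) = mr := by
  have hp' : 1 < p := by linarith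
  have h := alphaC_sigmaC hp' hm
  exact ⟨⟨sigmaC mr p, h, fun s hs => alphaC_injOn hp' hs.1 h.1 (hs.2.trans h.2.symm)⟩, h⟩
end
end

section
/- Assume there exist positive constants C, C₀, R₀, ε₀ and a constant b < −1 such that for every ε ∈ (0, ε₀) and every R > R₀ one has ∫_{B_R \ B_{R/2}} V^{−β+ε} dx ≤ C R^{α+C₀ε} (log R)^{b}. Then every stable weak solution u of −Δ_p u = V|u|^{σ−1}u on ℝ^m vanishes identically, i.e. u = 0 almost everywhere on ℝ^m. -/
open MeasureTheory Real Set Metric Filter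
open scoped ENNReal NNReal RealInnerProductSpace

noncomputable section

section

variable {m : ℕ}

/-- Young-type inequality with a parameter. -/
lemma rpow_mul_le_young {p δ a b : ℝ} (hp : 2 ≤ p) (hδ : 0 < δ) (ha : 0 ≤ a)
    (hb : 0 ≤ b) : a ^ (p - 2) * (a * b) ≤ δ * a ^ p + δ ^ (1 - p) * b ^ p := by
  have hap : a ^ p = a ^ (p - 2) * (a * a) := by
    rw [← sq, ← Real.rpow_natCast a 2, ← Real.rpow_add_of_nonneg ha (by linarith) (by norm_num)]
    norm_num
  rcases le_total b (δ * a) with h | h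
  · have : a ^ (p - 2) * (a * b) ≤ δ * a ^ p := by
      rw [hap]
      calc a ^ (p - 2) * (a * b) ≤ a ^ (p - 2) * (a * (δ * a)) := by gcongr
        _ = _ := by ring
    have : 0 ≤ δ ^ (1 - p) * b ^ p := by positivity
    linarith
  · have hab : a ≤ b / δ := by rw [le_div_iff₀ hδ]; linarith
    have : a ^ (p - 2) * (a * b) ≤ δ ^ (1 - p) * b ^ p := by
      calc a ^ (p - 2) * (a * b) = a ^ (p - 1) * b := by
            rw [← mul_assoc, ← Real.rpow_add_one' ha (by linarith)]; ring_nf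
        _ ≤ (b / δ) ^ (p - 1) * b := by gcongr; linarith
        _ = δ ^ (1 - p) * (b ^ (p - 1) * b) := by
            rw [Real.div_rpow hb hδ.le, show (1 - p) = -(p - 1) by ring, Real.rpow_neg hδ.le]
            ring
        _ = _ := by rw [← Real.rpow_add_one' hb (by linarith)]; ring_nf
    have : 0 ≤ δ * a ^ p := by positivity
    linarith

lemma rpow_mul_sq_le_young {p δ a b : ℝ} (hp : 2 ≤ p) (hδ : 0 < δ) (hδ1 : δ ≤ 1) (ha : 0 ≤ a)
    (hb : 0 ≤ b) : a ^ (p - 2) * b ^ 2 ≤ δ * a ^ p + δ ^ (1 - p) * b ^ p := by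
  rcases le_total b a with h | h
  · refine le_trans ?_ (rpow_mul_le_young hp hδ ha hb)
    rw [sq]; gcongr
  · have hbp : b ^ p = b ^ (p - 2) * b ^ 2 := by
      rw [← Real.rpow_natCast b 2, ← Real.rpow_add_of_nonneg hb (by linarith) (by norm_num)]
      norm_num
    have h1 : 1 ≤ δ ^ (1 - p) := Real.one_le_rpow_of_pos_of_le_one_of_nonpos hδ hδ1 (by linarith)
    have : a ^ (p - 2) * b ^ 2 ≤ 1 * b ^ p := by
      rw [one_mul, hbp]; gcongr
    have : 1 * b ^ p ≤ δ ^ (1 - p) * b ^ p := by gcongr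
    have : 0 ≤ δ * a ^ p := by positivity
    linarith

/-- Weighted arithmetic-geometric inequality in the form used to absorb terms. -/
lemma rpow_mul_rpow_le_add {A B s ν : ℝ} (hA : 0 ≤ A) (hB : 0 ≤ B) (hs : 0 < s) (hs1 : s < 1)
    (hν : 0 < ν) : A ^ s * B ^ (1 - s) ≤ ν ^ (1 - s) * A + ν ^ (-s) * B := by
  rcases le_total B (ν * A) with h | h
  · have : A ^ s * B ^ (1 - s) ≤ ν ^ (1 - s) * A := by
      calc A ^ s * B ^ (1 - s) ≤ A ^ s * (ν * A) ^ (1 - s) := by gcongr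
        _ = ν ^ (1 - s) * (A ^ s * A ^ (1 - s)) := by rw [Real.mul_rpow hν.le hA]; ring
        _ = _ := by
          rw [← Real.rpow_add_of_nonneg hA hs.le (by linarith)]; simp
    have : 0 ≤ ν ^ (-s) * B := by positivity
    linarith
  · have hAB : A ≤ B / ν := by rw [le_div_iff₀ hν]; linarith
    have : A ^ s * B ^ (1 - s) ≤ ν ^ (-s) * B := by
      calc A ^ s * B ^ (1 - s) ≤ (B / ν) ^ s * B ^ (1 - s) := by gcongr
        _ = ν ^ (-s) * (B ^ s * B ^ (1 - s)) := by
          rw [Real.div_rpow hB hν.le, Real.rpow_neg hν.le]; ring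
        _ = _ := by
          rw [← Real.rpow_add_of_nonneg hB hs.le (by linarith)]; simp
    have : 0 ≤ ν ^ (1 - s) * A := by positivity
    linarith

lemma weight_young {p σ γ n v t e d ν : ℝ} (hp : 2 ≤ p) (hσ : p - 1 < σ) (hγ : 1 < γ)
    (hn : p * (σ + γ) / (σ - p + 1) ≤ n) (hv : 0 < v) (ht : 0 ≤ t) (he : 0 ≤ e) (he1 : e ≤ 1)
    (hd : 0 ≤ d) (hν : 0 < ν) :
    t ^ (γ - 1) * e ^ (n - p) * (t * d) ^ p ≤
      ν ^ ((σ - p + 1) / (σ + γ)) * (v * t ^ (σ + γ) * e ^ n) +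
      ν ^ (-((γ + p - 1) / (σ + γ))) *
        (v ^ (-((γ + p - 1) / (σ - p + 1))) * d ^ (p * (σ + γ) / (σ - p + 1))) := by
  have hq : 0 < σ - p + 1 := by linarith
  have hsg : 0 < σ + γ := by linarith
  set s := (γ + p - 1) / (σ + γ) with hs
  have h1s : (σ - p + 1) / (σ + γ) = 1 - s := by rw [hs]; field_simp; ring
  have hs0 : 0 < s := by rw [hs]; apply div_pos <;> linarith
  have hs1 : s < 1 := by rw [hs, div_lt_one hsg]; linarith
  have hpn : p < n := by
    refine lt_of_lt_of_le ?_ hn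
    rw [lt_div_iff₀ hq]
    apply mul_lt_mul_of_pos_left <;> linarith
  have key := rpow_mul_rpow_le_add (A := v * t ^ (σ + γ) * e ^ n)
    (B := v ^ (-((γ + p - 1) / (σ - p + 1))) * d ^ (p * (σ + γ) / (σ - p + 1)))
    (by positivity) (by positivity) hs0 hs1 hν
  rw [h1s]
  refine le_trans ?_ key
  have hv1 : v ^ s * (v ^ (-((γ + p - 1) / (σ - p + 1)))) ^ (1 - s) = 1 := by
    rw [← Real.rpow_mul hv.le, ← Real.rpow_add hv, ← h1s, hs]
    convert Real.rpow_zero v using 2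
    field_simp; ring
  have hd1 : (d ^ (p * (σ + γ) / (σ - p + 1))) ^ (1 - s) = d ^ p := by
    rw [← Real.rpow_mul hd, ← h1s]
    congr 1; field_simp
  have ht1 : (t ^ (σ + γ)) ^ s = t ^ (γ - 1) * t ^ p := by
    rw [← Real.rpow_mul ht, ← Real.rpow_add_of_nonneg ht (by linarith) (by linarith), hs]
    congr 1; field_simp; ring
  have he2 : e ^ (n - p) ≤ (e ^ n) ^ s := by
    rw [← Real.rpow_mul he]
    apply Real.rpow_le_rpow_of_exponent_ge_of_imp he he1
    · have : p ≤ n * (1 - s) := by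
        rw [← h1s]
        rw [div_le_iff₀ hq] at hn
        rw [← mul_div_assoc, le_div_iff₀ hsg]; exact hn
      linarith
    · intro _ h
      linarith
  rw [Real.mul_rpow (x := v * t ^ (σ + γ)) (by positivity) (by positivity),
    Real.mul_rpow (x := v) (by positivity) (by positivity),
    Real.mul_rpow (y := d ^ (p * (σ + γ) / (σ - p + 1))) (by positivity) (by positivity), hd1, ht1]
  calc t ^ (γ - 1) * e ^ (n - p) * (t * d) ^ p
      = 1 * (t ^ (γ - 1) * t ^ p) * e ^ (n - p) * d ^ p := by
        rw [Real.mul_rpow ht hd]; ring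
    _ ≤ 1 * (t ^ (γ - 1) * t ^ p) * (e ^ n) ^ s * d ^ p := by gcongr
    _ = _ := by
        linear_combination -(t ^ (γ - 1) * t ^ p * (e ^ n) ^ s * d ^ p) * hv1

lemma hasDerivAt_abs_rpow_mul_self {s : ℝ} (hs : 0 < s) (t : ℝ) :
    HasDerivAt (fun t : ℝ => |t| ^ s * t) ((s + 1) * |t| ^ s) t := by
  rcases eq_or_ne t 0 with rfl | ht
  · rw [hasDerivAt_iff_tendsto_slope]
    have h1 : Tendsto (fun t : ℝ => |t| ^ s) (nhdsWithin 0 {0}ᶜ) (nhds ((s + 1) * |(0 : ℝ)| ^ s)) := by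
      have : Continuous (fun t : ℝ => |t| ^ s) := continuous_abs.rpow_const (fun _ => Or.inr hs.le)
      have h2 := (this.tendsto 0).mono_left (nhdsWithin_le_nhds (s := {0}ᶜ))
      simpa [Real.zero_rpow hs.ne'] using h2
    refine h1.congr' ?_
    filter_upwards [self_mem_nhdsWithin] with t ht
    have ht' : t ≠ 0 := ht
    simp [slope_def_field, ht']
  · have h := ((hasDerivAt_abs ht).rpow_const (p := s) (Or.inl (abs_ne_zero.2 ht))).mul
      (hasDerivAt_id t)
    refine h.congr_deriv ?_
    have h3 : (SignType.sign t : ℝ) * t = |t| := by simp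
    have h4 : |t| ^ s = |t| ^ (s - 1) * |t| := by
      rw [← Real.rpow_add_one (abs_ne_zero.2 ht)]; ring_nf
    simp only [id, mul_one]
    rw [h4]
    linear_combination (s * |t| ^ (s - 1)) * h3

lemma contDiff_abs_rpow_mul_self {s : ℝ} (hs : 0 < s) :
    ContDiff ℝ 1 (fun t : ℝ => |t| ^ s * t) := by
  rw [contDiff_one_iff_deriv]
  refine ⟨fun t => (hasDerivAt_abs_rpow_mul_self hs t).differentiableAt, ?_⟩
  have : deriv (fun t : ℝ => |t| ^ s * t) = fun t => (s + 1) * |t| ^ s :=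
    funext fun t => (hasDerivAt_abs_rpow_mul_self hs t).deriv
  rw [this]
  exact continuous_const.mul (continuous_abs.rpow_const (fun _ => Or.inr hs.le))

lemma continuous_gradient {u : Em m → ℝ} (hu : ContDiff ℝ 1 u) : Continuous (gradient u) :=
  (InnerProductSpace.toDual ℝ (Em m)).symm.continuous.comp (hu.continuous_fderiv one_ne_zero)

lemma hasCompactSupport_gradient {η : Em m → ℝ} (hη : HasCompactSupport η) :
    HasCompactSupport (gradient η) :=
  (hη.fderiv (𝕜 := ℝ)).comp_left (g := (InnerProductSpace.toDual ℝ (Em m)).symm) (map_zero _)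

/-- The gradient of the test functions `|u|^s u η^(n+1)`. -/
lemma gradient_testFunction {u η : Em m → ℝ} (hu : ContDiff ℝ 1 u) (hη : ContDiff ℝ 1 η) {s : ℝ}
    (hs : 0 < s) (n : ℕ) (x : Em m) :
    gradient (fun x => |u x| ^ s * u x * η x ^ (n + 1)) x =
      (|u x| ^ s * η x ^ n) • ((s + 1) • η x • gradient u x + ((n + 1 : ℕ) : ℝ) • u x • gradient η x) := by
  have h1 := (hu.differentiable one_ne_zero x).hasFDerivAt
  have h2 := (hη.differentiable one_ne_zero x).hasFDerivAt
  have h3 := ((hasDerivAt_abs_rpow_mul_self hs (u x)).comp_hasFDerivAt x h1).mul (h2.pow (n + 1))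
  have h4 : HasFDerivAt (fun x => |u x| ^ s * u x * η x ^ (n + 1)) _ x := h3
  rw [gradient, h4.fderiv]
  simp only [map_add, map_smul, gradient, Function.comp]
  simp only [smul_add, smul_smul, add_tsub_cancel_right, nsmul_eq_mul]
  rw [add_comm]
  congr 2 <;> ring

lemma lipCS_testFunction {u η : Em m → ℝ} (hu : ContDiff ℝ 1 u) (hη : ContDiff ℝ 1 η)
    (hηs : HasCompactSupport η) {s : ℝ} (hs : 0 < s) (n : ℕ) :
    LipCS (fun x => |u x| ^ s * u x * η x ^ (n + 1)) := by
  have h1 : ContDiff ℝ 1 (fun x => |u x| ^ s * u x * η x ^ (n + 1)) :=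
    ((contDiff_abs_rpow_mul_self hs).comp hu).mul (hη.pow (n + 1))
  have h2 : HasCompactSupport (fun x => |u x| ^ s * u x * η x ^ (n + 1)) :=
    HasCompactSupport.mul_left
      (hηs.comp_left (g := fun t : ℝ => t ^ (n + 1)) (by simp))
  exact ⟨h1.lipschitzWith_of_hasCompactSupport h2 one_ne_zero, h2⟩

lemma rpow_mul_pow_eq {p g e : ℝ} (k : ℕ) (hp : 2 ≤ p) (hk : p ≤ 2 * ((k : ℝ) + 1)) (hg : 0 ≤ g)
    (he : 0 ≤ e) :
    g ^ (p - 2) * e ^ (2 * k) = e ^ (2 * ((k : ℝ) + 1) - p) * (g * e) ^ (p - 2) := by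
  rw [Real.mul_rpow hg he, ← Real.rpow_natCast e (2 * k)]
  have : ((2 * k : ℕ) : ℝ) = (2 * ((k : ℝ) + 1) - p) + (p - 2) := by push_cast; ring
  rw [this, Real.rpow_add_of_nonneg he (by linarith) (by linarith)]
  ring

lemma rpow_sub_two_mul_sq {p a : ℝ} (hp : 2 ≤ p) (ha : 0 ≤ a) : a ^ (p - 2) * a ^ 2 = a ^ p := by
  rw [← Real.rpow_natCast a 2, ← Real.rpow_add_of_nonneg ha (by linarith) (by norm_num)]
  norm_num

/-- Pointwise bound for the stability quadratic form on the test function. -/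
lemma stability_integrand_le {u η : Em m → ℝ} (hu : ContDiff ℝ 1 u) (hη : ContDiff ℝ 1 η)
    (hη0 : ∀ x, 0 ≤ η x) {p γ δ : ℝ} {k : ℕ} (hp : 2 ≤ p) (hγ : 1 < γ)
    (hk : p ≤ 2 * ((k : ℝ) + 1)) (hδ : 0 < δ) (hδ1 : δ ≤ 1) (x : Em m) :
    ‖gradient u x‖ ^ (p - 2) *
        ‖gradient (fun x => |u x| ^ ((γ - 1) / 2) * u x * η x ^ (k + 1)) x‖ ^ 2 ≤
      ((γ + 1) ^ 2 / 4 + ((γ + 1) * (k + 1) + (k + 1) ^ 2) * δ) *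
        (|u x| ^ (γ - 1) * η x ^ (2 * ((k : ℝ) + 1) - p) * (‖gradient u x‖ * η x) ^ p) +
      ((γ + 1) * (k + 1) + (k + 1) ^ 2) * δ ^ (1 - p) *
        (|u x| ^ (γ - 1) * η x ^ (2 * ((k : ℝ) + 1) - p) * (|u x| * ‖gradient η x‖) ^ p) := by
  have he := hη0 x
  rw [gradient_testFunction hu hη (by linarith) k x]
  set a := ‖gradient u x‖ * η x with ha
  set b := |u x| * ‖gradient η x‖ with hb
  have ha0 : 0 ≤ a := by positivity
  have hb0 : 0 ≤ b := by positivity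
  set w := |u x| ^ (γ - 1) * η x ^ (2 * ((k : ℝ) + 1) - p) with hw
  have hw0 : 0 ≤ w := by positivity
  have hn : ‖(|u x| ^ ((γ - 1) / 2) * η x ^ k) • (((γ - 1) / 2 + 1) • η x • gradient u x +
      ((k + 1 : ℕ) : ℝ) • u x • gradient η x)‖ ≤
      |u x| ^ ((γ - 1) / 2) * η x ^ k * ((γ + 1) / 2 * a + (k + 1) * b) := by
    rw [norm_smul, Real.norm_of_nonneg (by positivity)]
    gcongr
    refine (norm_add_le _ _).trans (le_of_eq ?_)
    simp only [norm_smul, Real.norm_eq_abs]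
    rw [abs_of_nonneg he, abs_of_nonneg (by linarith : 0 ≤ (γ - 1) / 2 + 1), Nat.abs_cast]
    push_cast
    rw [ha, hb]; ring
  have hsq : (|u x| ^ ((γ - 1) / 2)) ^ 2 = |u x| ^ (γ - 1) := by
    rw [← Real.rpow_natCast, ← Real.rpow_mul (abs_nonneg _)]; congr 1; push_cast; ring
  have h1 := rpow_mul_le_young hp hδ ha0 hb0
  have h2 := rpow_mul_sq_le_young hp hδ hδ1 ha0 hb0
  calc _ ≤ ‖gradient u x‖ ^ (p - 2) *
        (|u x| ^ ((γ - 1) / 2) * η x ^ k * ((γ + 1) / 2 * a + (k + 1) * b)) ^ 2 := by gcongr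
    _ = (|u x| ^ ((γ - 1) / 2)) ^ 2 * (‖gradient u x‖ ^ (p - 2) * η x ^ (2 * k)) *
        ((γ + 1) / 2 * a + (k + 1) * b) ^ 2 := by ring
    _ = w * (a ^ (p - 2) * ((γ + 1) / 2 * a + (k + 1) * b) ^ 2) := by
        rw [hsq, rpow_mul_pow_eq k hp hk (norm_nonneg _) he]; ring
    _ = w * ((γ + 1) ^ 2 / 4 * (a ^ (p - 2) * a ^ 2) + (γ + 1) * (k + 1) * (a ^ (p - 2) * (a * b)) +
        (k + 1) ^ 2 * (a ^ (p - 2) * b ^ 2)) := by ring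
    _ ≤ w * ((γ + 1) ^ 2 / 4 * a ^ p + (γ + 1) * (k + 1) * (δ * a ^ p + δ ^ (1 - p) * b ^ p) +
        (k + 1) ^ 2 * (δ * a ^ p + δ ^ (1 - p) * b ^ p)) := by
        rw [rpow_sub_two_mul_sq hp ha0]; gcongr
    _ = _ := by ring

/-- Pointwise lower bound for the weak formulation tested with `|u|^(γ-1) u η^(2k+2)`. -/
lemma weak_integrand_ge {u η : Em m → ℝ} (hu : ContDiff ℝ 1 u) (hη : ContDiff ℝ 1 η)
    (hη0 : ∀ x, 0 ≤ η x) {p γ δ : ℝ} {k : ℕ} (hp : 2 ≤ p) (hγ : 1 < γ)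
    (hk : p ≤ 2 * ((k : ℝ) + 1)) (hδ : 0 < δ) (x : Em m) :
    (γ - 2 * ((k : ℝ) + 1) * δ) *
        (|u x| ^ (γ - 1) * η x ^ (2 * ((k : ℝ) + 1) - p) * (‖gradient u x‖ * η x) ^ p) -
      2 * ((k : ℝ) + 1) * δ ^ (1 - p) *
        (|u x| ^ (γ - 1) * η x ^ (2 * ((k : ℝ) + 1) - p) * (|u x| * ‖gradient η x‖) ^ p) ≤
    ‖gradient u x‖ ^ (p - 2) *
        ⟪gradient u x, gradient (fun x => |u x| ^ (γ - 1) * u x * η x ^ (2 * k + 1 + 1)) x⟫ := by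
  have he := hη0 x
  rw [gradient_testFunction hu hη (by linarith) (2 * k + 1) x]
  set a := ‖gradient u x‖ * η x with ha
  set b := |u x| * ‖gradient η x‖ with hb
  have ha0 : 0 ≤ a := by positivity
  have hb0 : 0 ≤ b := by positivity
  set w := |u x| ^ (γ - 1) * η x ^ (2 * ((k : ℝ) + 1) - p) with hw
  have hw0 : 0 ≤ w := by positivity
  have h1 := rpow_mul_le_young hp hδ ha0 hb0
  have hin : γ * a ^ 2 - 2 * ((k : ℝ) + 1) * (a * b) ≤ η x *
      ⟪gradient u x, ((γ - 1 + 1) • η x • gradient u x +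
        ((2 * k + 1 + 1 : ℕ) : ℝ) • u x • gradient η x)⟫ := by
    rw [inner_add_right]
    simp only [inner_smul_right, real_inner_self_eq_norm_sq]
    have h3 : -(|u x| * (‖gradient u x‖ * ‖gradient η x‖)) ≤ u x * ⟪gradient u x, gradient η x⟫ := by
      have := abs_real_inner_le_norm (gradient u x) (gradient η x)
      have h4 : |u x * ⟪gradient u x, gradient η x⟫| ≤ |u x| * (‖gradient u x‖ * ‖gradient η x‖) := by
        rw [abs_mul]; gcongr
      exact (abs_le.1 h4).1
    have h5 : 0 ≤ η x * ((2 * k + 1 + 1 : ℕ) : ℝ) := by positivity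
    have h6 := mul_le_mul_of_nonneg_left h3 h5
    push_cast at h6 ⊢
    rw [ha, hb]
    linarith
  have h7 : 0 ≤ ‖gradient u x‖ ^ (p - 2) * (|u x| ^ (γ - 1) * η x ^ (2 * k)) := by positivity
  rw [inner_smul_right]
  calc _ = w * (γ * a ^ p - 2 * ((k : ℝ) + 1) * (δ * a ^ p + δ ^ (1 - p) * b ^ p)) := by ring
    _ ≤ w * (γ * a ^ p - 2 * ((k : ℝ) + 1) * (a ^ (p - 2) * (a * b))) := by gcongr
    _ = w * a ^ (p - 2) * (γ * a ^ 2 - 2 * ((k : ℝ) + 1) * (a * b)) := by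
        rw [← rpow_sub_two_mul_sq hp ha0]; ring
    _ = ‖gradient u x‖ ^ (p - 2) * (|u x| ^ (γ - 1) * η x ^ (2 * k)) *
          (γ * a ^ 2 - 2 * ((k : ℝ) + 1) * (a * b)) := by
        rw [hw, mul_assoc (|u x| ^ (γ - 1)), ← rpow_mul_pow_eq k hp hk (norm_nonneg _) he]; ring
    _ ≤ _ := mul_le_mul_of_nonneg_left hin h7
    _ = _ := by rw [pow_succ]; ring

lemma integrable_gradient_energy {u η : Em m → ℝ} (hu : ContDiff ℝ 1 u) (hη : ContDiff ℝ 1 η)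
    (hηs : HasCompactSupport η) {p γ n : ℝ} (hp : 0 < p) (hγ : 1 < γ) (hn : p < n) :
    Integrable (fun x => |u x| ^ (γ - 1) * η x ^ (n - p) * (‖gradient u x‖ * η x) ^ p) := by
  have hg := continuous_gradient hu
  refine Continuous.integrable_of_hasCompactSupport ?_ (hηs.mono ?_)
  · exact ((hu.continuous.abs.rpow_const fun _ => Or.inr (by linarith)).mul
      (hη.continuous.rpow_const fun _ => Or.inr (by linarith))).mul
      ((hg.norm.mul hη.continuous).rpow_const fun _ => Or.inr hp.le)
  · intro x hx h
    apply hx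
    simp only [h, mul_zero, Real.zero_rpow hp.ne']

lemma integrable_cutoff_energy {u η : Em m → ℝ} (hu : ContDiff ℝ 1 u) (hη : ContDiff ℝ 1 η)
    (hηs : HasCompactSupport η) {p γ n : ℝ} (hp : 0 < p) (hγ : 1 < γ) (hn : p < n) :
    Integrable (fun x => |u x| ^ (γ - 1) * η x ^ (n - p) * (|u x| * ‖gradient η x‖) ^ p) := by
  have hg := continuous_gradient hη
  refine Continuous.integrable_of_hasCompactSupport ?_ (hηs.mono ?_)
  · exact ((hu.continuous.abs.rpow_const fun _ => Or.inr (by linarith)).mul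
      (hη.continuous.rpow_const fun _ => Or.inr (by linarith))).mul
      ((hu.continuous.abs.mul hg.norm).rpow_const fun _ => Or.inr hp.le)
  · intro x hx h
    apply hx
    have : n - p ≠ 0 := by linarith
    simp only [h, Real.zero_rpow this, mul_zero, zero_mul]

lemma integrable_potential_energy {V u η : Em m → ℝ} (hV : LocallyIntegrable V volume)
    (hu : ContDiff ℝ 1 u) (hη : ContDiff ℝ 1 η) (hηs : HasCompactSupport η) {r n : ℝ} (hr : 0 < r)
    (hn : 0 < n) : Integrable (fun x => V x * |u x| ^ r * η x ^ n) := by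
  have h := hV.integrable_smul_left_of_hasCompactSupport (g := fun x => |u x| ^ r * η x ^ n) ?_
    (hηs.mono ?_)
  · refine h.congr (Eventually.of_forall fun x => ?_)
    simp only [smul_eq_mul]; ring
  · exact (hu.continuous.abs.rpow_const fun _ => Or.inr hr.le).mul
      (hη.continuous.rpow_const fun _ => Or.inr hn.le)
  · intro x hx h
    apply hx
    simp only [h, Real.zero_rpow hn.ne', mul_zero]

/-- Energy inequality from stability. -/
lemma IsStable.energy_le {V u η : Em m → ℝ} {p σ γ δ : ℝ} {k : ℕ} (hst : IsStable p σ V u)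
    (hu : ContDiff ℝ 1 u) (hη : ContDiff ℝ 1 η) (hηs : HasCompactSupport η)
    (hη0 : ∀ x, 0 ≤ η x) (hp : 2 ≤ p) (hσ : p - 1 < σ) (hγ : 1 < γ)
    (hk : p < 2 * ((k : ℝ) + 1)) (hδ : 0 < δ) (hδ1 : δ ≤ 1) :
    σ * ∫ x, V x * |u x| ^ (σ + γ) * η x ^ (2 * ((k : ℝ) + 1)) ≤
      (p - 1) * (((γ + 1) ^ 2 / 4 + ((γ + 1) * (k + 1) + (k + 1) ^ 2) * δ) *
        (∫ x, |u x| ^ (γ - 1) * η x ^ (2 * ((k : ℝ) + 1) - p) * (‖gradient u x‖ * η x) ^ p) +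
      ((γ + 1) * (k + 1) + (k + 1) ^ 2) * δ ^ (1 - p) *
        ∫ x, |u x| ^ (γ - 1) * η x ^ (2 * ((k : ℝ) + 1) - p) * (|u x| * ‖gradient η x‖) ^ p) := by
  have hs := hst _ (lipCS_testFunction hu hη hηs (s := (γ - 1) / 2) (by linarith) k)
  have hP := integrable_gradient_energy hu hη hηs (by linarith) hγ hk
  have hQ := integrable_cutoff_energy hu hη hηs (by linarith) hγ hk
  set φ := fun x => |u x| ^ ((γ - 1) / 2) * u x * η x ^ (k + 1) with hφ
  have hpt := fun x => stability_integrand_le hu hη hη0 hp hγ hk.le hδ hδ1 x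
  rw [← hφ] at hpt
  have h_int := (hP.const_mul ((γ + 1) ^ 2 / 4 + ((γ + 1) * (k + 1) + (k + 1) ^ 2) * δ)).add
    (hQ.const_mul (((γ + 1) * (k + 1) + (k + 1) ^ 2) * δ ^ (1 - p)))
  have h1 : ∫ x, ‖gradient u x‖ ^ (p - 2) * ‖gradient φ x‖ ^ 2 ≤ _ :=
    integral_mono_of_nonneg (Eventually.of_forall fun x => by positivity) h_int
      (Eventually.of_forall hpt)
  have hle (x : Em m) : ‖gradient u x‖ ^ (p - 4) * ⟪gradient u x, gradient φ x⟫ ^ 2 ≤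
      ‖gradient u x‖ ^ (p - 2) * ‖gradient φ x‖ ^ 2 := by
    rcases eq_or_ne ‖gradient u x‖ 0 with h0 | h0
    · have : gradient u x = 0 := norm_eq_zero.1 h0
      rw [this, inner_zero_left, zero_pow two_ne_zero, mul_zero]
      positivity
    · have hc : ⟪gradient u x, gradient φ x⟫ ^ 2 ≤ (‖gradient u x‖ * ‖gradient φ x‖) ^ 2 :=
        sq_le_sq' (neg_le_of_abs_le (abs_real_inner_le_norm _ _)) (real_inner_le_norm _ _)
      calc _ ≤ ‖gradient u x‖ ^ (p - 4) * (‖gradient u x‖ * ‖gradient φ x‖) ^ 2 := by gcongr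
        _ = (‖gradient u x‖ ^ (p - 4) * ‖gradient u x‖ ^ 2) * ‖gradient φ x‖ ^ 2 := by ring
        _ = _ := by
          rw [← Real.rpow_natCast ‖gradient u x‖ 2,
            ← Real.rpow_add (lt_of_le_of_ne (norm_nonneg _) h0.symm)]
          congr 2; push_cast; ring
  have h2 : ∫ x, ‖gradient u x‖ ^ (p - 4) * ⟪gradient u x, gradient φ x⟫ ^ 2 ≤ _ :=
    integral_mono_of_nonneg (Eventually.of_forall fun x => by positivity) h_int
      (Eventually.of_forall fun x => (hle x).trans (hpt x))
  have hY : ∫ x, V x * |u x| ^ (σ - 1) * φ x ^ 2 =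
      ∫ x, V x * |u x| ^ (σ + γ) * η x ^ (2 * ((k : ℝ) + 1)) := by
    refine integral_congr_ae (Eventually.of_forall fun x => ?_)
    simp only [hφ]
    have e1 : η x ^ (2 * ((k : ℝ) + 1)) = (η x ^ (k + 1)) ^ 2 := by
      rw [← pow_mul, ← Real.rpow_natCast]; congr 1; push_cast; ring
    have e2 : |u x| ^ (σ + γ) = |u x| ^ (σ - 1) * ((|u x| ^ ((γ - 1) / 2)) ^ 2 * |u x| ^ 2) := by
      rw [← Real.rpow_natCast, ← Real.rpow_natCast, ← Real.rpow_mul (abs_nonneg _),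
        ← Real.rpow_add_of_nonneg (abs_nonneg _) (by push_cast; linarith) (by norm_num),
        ← Real.rpow_add_of_nonneg (abs_nonneg _) (by linarith) (by push_cast; linarith)]
      congr 1; push_cast; ring
    rw [e1, e2, sq_abs]; ring
  rw [hY] at hs
  have h3 := add_le_add h1 (mul_le_mul_of_nonneg_left h2 (by linarith : 0 ≤ p - 2))
  refine hs.trans (h3.trans (le_of_eq ?_))
  simp only [Pi.add_apply]
  rw [integral_add (hP.const_mul _) (hQ.const_mul _), integral_const_mul, integral_const_mul]
  ring

/-- Energy inequality from the equation. -/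
lemma IsWeakSol.energy_le {V u η : Em m → ℝ} {p σ γ δ : ℝ} {k : ℕ} (hw : IsWeakSol p σ V u)
    (hη : ContDiff ℝ 1 η) (hηs : HasCompactSupport η)
    (hη0 : ∀ x, 0 ≤ η x) (hp : 2 ≤ p) (hσ : p - 1 < σ) (hγ : 1 < γ)
    (hk : p < 2 * ((k : ℝ) + 1)) (hδ : 0 < δ) :
    (γ - 2 * ((k : ℝ) + 1) * δ) *
        (∫ x, |u x| ^ (γ - 1) * η x ^ (2 * ((k : ℝ) + 1) - p) * (‖gradient u x‖ * η x) ^ p) -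
      2 * ((k : ℝ) + 1) * δ ^ (1 - p) *
        (∫ x, |u x| ^ (γ - 1) * η x ^ (2 * ((k : ℝ) + 1) - p) * (|u x| * ‖gradient η x‖) ^ p) ≤
      ∫ x, V x * |u x| ^ (σ + γ) * η x ^ (2 * ((k : ℝ) + 1)) := by
  obtain ⟨hu, -, -, hw⟩ := hw
  have hL := lipCS_testFunction hu hη hηs (s := γ - 1) (by linarith) (2 * k + 1)
  have hs := hw _ hL
  have hP := integrable_gradient_energy hu hη hηs (by linarith) hγ hk
  have hQ := integrable_cutoff_energy hu hη hηs (by linarith) hγ hk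
  have hpt := fun x => weak_integrand_ge hu hη hη0 hp hγ hk.le hδ x
  have hC1 : ContDiff ℝ 1 (fun x => |u x| ^ (γ - 1) * u x * η x ^ (2 * k + 1 + 1)) :=
    ((contDiff_abs_rpow_mul_self (by linarith)).comp hu).mul (hη.pow (2 * k + 1 + 1))
  set φ := fun x => |u x| ^ (γ - 1) * u x * η x ^ (2 * k + 1 + 1) with hφ
  have hY : ∫ x, V x * |u x| ^ (σ - 1) * u x * φ x =
      ∫ x, V x * |u x| ^ (σ + γ) * η x ^ (2 * ((k : ℝ) + 1)) := by
    refine integral_congr_ae (Eventually.of_forall fun x => ?_)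
    simp only [hφ]
    have e1 : η x ^ (2 * ((k : ℝ) + 1)) = η x ^ (2 * k + 1 + 1) := by
      rw [← Real.rpow_natCast]; congr 1; push_cast; ring
    have e2 : |u x| ^ (σ + γ) = |u x| ^ (σ - 1) * (|u x| ^ (γ - 1) * |u x| ^ 2) := by
      rw [← Real.rpow_natCast,
        ← Real.rpow_add_of_nonneg (abs_nonneg _) (by linarith) (by norm_num),
        ← Real.rpow_add_of_nonneg (abs_nonneg _) (by linarith) (by push_cast; linarith)]
      congr 1; push_cast; ring
    rw [e1, e2, sq_abs]; ring
  have hI : Integrable (fun x => ‖gradient u x‖ ^ (p - 2) * ⟪gradient u x, gradient φ x⟫) := by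
    have hg := continuous_gradient hu
    refine Continuous.integrable_of_hasCompactSupport
      ((hg.norm.rpow_const fun _ => Or.inr (by linarith)).mul
        (hg.inner (continuous_gradient hC1)))
      ((hasCompactSupport_gradient hL.2).mono fun x hx h => hx ?_)
    simp only [h, inner_zero_right, mul_zero]
  rw [← hY, ← hs]
  refine le_trans (le_of_eq ?_) (integral_mono ((hP.const_mul _).sub (hQ.const_mul _)) hI hpt)
  simp only [Pi.sub_apply]
  rw [integral_sub (hP.const_mul _) (hQ.const_mul _), integral_const_mul, integral_const_mul]

lemma one_lt_gammaBar {p σ : ℝ} (hp : 2 ≤ p) (hσ : p - 1 < σ) : 1 < gammaBar p σ := by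
  rw [gammaBar, lt_div_iff₀ (by linarith)]
  have := Real.sqrt_nonneg (σ * (σ - p + 1))
  linarith

lemma gammaBar_quadratic {p σ : ℝ} (hp : 2 ≤ p) (hσ : p - 1 < σ) :
    (p - 1) * (gammaBar p σ + 1) ^ 2 = 4 * σ * gammaBar p σ := by
  have h1 : 0 < p - 1 := by linarith
  have hs : Real.sqrt (σ * (σ - p + 1)) ^ 2 = σ * (σ - p + 1) :=
    Real.sq_sqrt (mul_nonneg (by linarith) (by linarith))
  have hΓ : (p - 1) * gammaBar p σ = 2 * σ - p + 1 + 2 * Real.sqrt (σ * (σ - p + 1)) := by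
    rw [gammaBar]; field_simp
  set s := Real.sqrt (σ * (σ - p + 1))
  set Γ := gammaBar p σ
  have h2 : (p - 1) * ((p - 1) * (Γ + 1) ^ 2 - 4 * σ * Γ) = 0 := by
    linear_combination ((p - 1) * Γ + (2 * σ - p + 1 + 2 * s) + 2 * (p - 1) - 4 * σ) * hΓ + 4 * hs
  rcases mul_eq_zero.1 h2 with h | h
  · linarith
  · linarith

lemma gap_gammaBar {p σ γ : ℝ} (hp : 2 ≤ p) (hσ : p - 1 < σ) (hγ : 1 ≤ γ)
    (hγ' : γ ≤ gammaBar p σ) :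
    (p - 1) / 4 * (1 - (gammaBar p σ)⁻¹) * (gammaBar p σ - γ) ≤
      σ * γ - (p - 1) * (γ + 1) ^ 2 / 4 := by
  have h1 := one_lt_gammaBar hp hσ
  have h2 := gammaBar_quadratic hp hσ
  set Γ := gammaBar p σ
  have hσ' : σ = (p - 1) * (Γ + 1) ^ 2 / (4 * Γ) := by
    field_simp; linarith
  have h3 : σ * γ - (p - 1) * (γ + 1) ^ 2 / 4 = (p - 1) / 4 * (γ - Γ⁻¹) * (Γ - γ) := by
    rw [hσ']; field_simp; ring
  rw [h3]
  gcongr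
  all_goals linarith

/-- Absorption of the gradient and cutoff terms, with the precise dependence on `ε`. -/
lemma exists_absorption_constant {p c K₁ K₂ Γ : ℝ} (hc : 0 < c) (hK₁ : 0 < K₁)
    (hK₂ : 0 < K₂) (hΓ : 0 < Γ) :
    ∃ M : ℝ, 1 ≤ M ∧ ∀ ε X Y Z : ℝ, 0 < ε → ε ≤ Γ → 0 ≤ Y → 0 ≤ Z →
      (∀ δ : ℝ, 0 < δ → δ ≤ 1 → c * ε * Y ≤ K₂ * (δ * X + δ ^ (1 - p) * Z) ∧
        X ≤ Y + K₁ * (δ * X + δ ^ (1 - p) * Z)) → ε ^ p * Y ≤ M * Z := by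
  set l := min (min (c / (4 * K₂)) (1 / (2 * K₁ * Γ))) (1 / Γ) with hl
  have hl0 : 0 < l := by positivity
  refine ⟨max 1 (4 * K₂ * l ^ (1 - p) / c), le_max_left _ _, ?_⟩
  intro ε X Y Z hε hεΓ hY hZ h
  have hl1 : l ≤ c / (4 * K₂) := (min_le_left _ _).trans (min_le_left _ _)
  have hl2 : l ≤ 1 / (2 * K₁ * Γ) := (min_le_left _ _).trans (min_le_right _ _)
  have hl3 : l ≤ 1 / Γ := min_le_right _ _
  rw [le_div_iff₀ (by positivity)] at hl1 hl2 hl3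
  have hd0 : 0 < l * ε := by positivity
  have hd1 : l * ε ≤ l * Γ := by gcongr
  obtain ⟨h1, h2⟩ := h (l * ε) hd0 (by linarith)
  set D := (l * ε) ^ (1 - p) * Z with hD
  have hD0 : 0 ≤ D := by positivity
  have hKd : K₁ * (l * ε) ≤ 1 / 2 := by
    have : K₁ * (l * ε) ≤ K₁ * (l * Γ) := by gcongr
    linarith
  have hX : X ≤ 2 * Y + 2 * K₁ * D := by
    rcases le_total X 0 with hX0 | hX0
    · have : 0 ≤ K₁ * D := by positivity
      linarith
    · have := mul_le_mul_of_nonneg_right hKd hX0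
      linarith
  have hdX : l * ε * X ≤ 2 * (l * ε) * Y + D := by
    have h3 := mul_le_mul_of_nonneg_left hX hd0.le
    have h4 := mul_le_mul_of_nonneg_right hKd hD0
    linarith
  have h5 : c * ε * Y ≤ K₂ * (2 * (l * ε) * Y + 2 * D) :=
    h1.trans (mul_le_mul_of_nonneg_left (by linarith) hK₂.le)
  have h6 : l * (4 * K₂) * (ε * Y) ≤ c * (ε * Y) := by gcongr
  have h7 : c * (ε * Y) ≤ 4 * K₂ * D := by linarith
  have h8 : ε ^ p * Y = ε ^ (p - 1) * (ε * Y) := by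
    rw [← mul_assoc, ← Real.rpow_add_one hε.ne']; ring_nf
  have h9 : ε ^ (p - 1) * D = l ^ (1 - p) * Z := by
    rw [hD, Real.mul_rpow hl0.le hε.le]
    have : ε ^ (p - 1) * ε ^ (1 - p) = 1 := by
      rw [← Real.rpow_add hε]; simp
    linear_combination (l ^ (1 - p) * Z) * this
  have h10 : ε ^ p * Y ≤ 4 * K₂ * l ^ (1 - p) / c * Z := by
    rw [div_mul_eq_mul_div, le_div_iff₀ hc, h8]
    have := mul_le_mul_of_nonneg_left h7 (by positivity : 0 ≤ ε ^ (p - 1))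
    linear_combination this + 4 * K₂ * h9
  exact h10.trans (by gcongr; exact le_max_right _ _)

/-- The a priori estimate, with explicit blow-up as `γ` tends to the critical exponent. -/
lemma exists_apriori_constant {V u : Em m → ℝ} {p σ : ℝ} (hp : 2 ≤ p) (hσ : p - 1 < σ)
    (hV : LocallyIntegrable V volume) (hVpos : ∀ᵐ x : Em m, 0 < V x)
    (hu : IsWeakSol p σ V u) (hst : IsStable p σ V u) {k : ℕ}
    (hk : alphaC p σ ≤ 2 * ((k : ℝ) + 1)) :
    ∃ M : ℝ, 1 ≤ M ∧ ∀ γ : ℝ, 1 < γ → γ < gammaBar p σ → ∀ η : Em m → ℝ, ContDiff ℝ 1 η →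
      HasCompactSupport η → (∀ x, 0 ≤ η x) → (∀ x, η x ≤ 1) →
      Integrable (fun x => V x ^ (-((γ + p - 1) / (σ - p + 1))) *
        ‖gradient η x‖ ^ (p * (σ + γ) / (σ - p + 1))) →
      ∫ x, V x * |u x| ^ (σ + γ) * η x ^ (2 * ((k : ℝ) + 1)) ≤
        (M / (gammaBar p σ - γ)) ^ (p * (σ + γ) / (σ - p + 1)) *
        ∫ x, V x ^ (-((γ + p - 1) / (σ - p + 1))) *
          ‖gradient η x‖ ^ (p * (σ + γ) / (σ - p + 1)) := by
  have hΓ := one_lt_gammaBar hp hσ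
  have hgap := fun γ => gap_gammaBar (γ := γ) hp hσ
  have hα : alphaC p σ = p * (σ + gammaBar p σ) / (σ - p + 1) := rfl
  set Γ := gammaBar p σ with hΓdef
  have hq : 0 < σ - p + 1 := by linarith
  have hΓi : Γ⁻¹ < 1 := inv_lt_one_of_one_lt₀ hΓ
  set c := (p - 1) / 4 * (1 - Γ⁻¹) with hc
  have hc0 : 0 < c := mul_pos (by linarith) (by linarith)
  set K₁ := p * ((Γ + 1) * (k + 1) + (k + 1) ^ 2) + 2 * ((k : ℝ) + 1) with hK₁
  have hK₁0 : 0 < K₁ := by positivity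
  set K₂ := (σ * Γ + Γ) * K₁ with hK₂
  have hσ0 : 0 < σ := by linarith
  obtain ⟨M, hM, hMest⟩ := exists_absorption_constant (p := p) (c := c) (K₁ := K₁) (K₂ := K₂)
    (Γ := Γ) hc0 hK₁0 (by positivity) (by linarith)
  refine ⟨2 * M, by linarith, ?_⟩
  intro γ hγ hγΓ η hη hηs hη0 hη1 hWint
  have hkp : p < 2 * ((k : ℝ) + 1) := by
    refine lt_of_lt_of_le ?_ hk
    rw [hα, lt_div_iff₀ hq]
    apply mul_lt_mul_of_pos_left <;> linarith
  have hαk : p * (σ + γ) / (σ - p + 1) ≤ 2 * ((k : ℝ) + 1) := by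
    refine le_trans ?_ hk
    rw [hα]; gcongr
  have hP := integrable_gradient_energy hu.1 hη hηs (by linarith) hγ hkp
  have hQ := integrable_cutoff_energy hu.1 hη hηs (by linarith) hγ hkp
  have hA := integrable_potential_energy hV hu.1 hη hηs (r := σ + γ) (n := 2 * ((k : ℝ) + 1))
    (by linarith) (by linarith)
  have hE1 := fun δ => hst.energy_le (δ := δ) (k := k) hu.1 hη hηs hη0 hp hσ hγ hkp
  have hE2 := fun δ => hu.energy_le (δ := δ) (k := k) hη hηs hη0 hp hσ hγ hkp
  set X := ∫ x, |u x| ^ (γ - 1) * η x ^ (2 * ((k : ℝ) + 1) - p) * (‖gradient u x‖ * η x) ^ p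
  set Z := ∫ x, |u x| ^ (γ - 1) * η x ^ (2 * ((k : ℝ) + 1) - p) * (|u x| * ‖gradient η x‖) ^ p
    with hZ
  set Y := ∫ x, V x * |u x| ^ (σ + γ) * η x ^ (2 * ((k : ℝ) + 1)) with hY
  set W := ∫ x, V x ^ (-((γ + p - 1) / (σ - p + 1))) *
          ‖gradient η x‖ ^ (p * (σ + γ) / (σ - p + 1)) with hW
  have hX0 : 0 ≤ X := integral_nonneg fun x => by have := hη0 x; positivity
  have hZ0 : 0 ≤ Z := integral_nonneg fun x => by have := hη0 x; positivity
  have hY0 : 0 ≤ Y := integral_nonneg_of_ae <| by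
    filter_upwards [hVpos] with x hx
    have := hη0 x
    simp only [Pi.zero_apply]
    positivity
  have hest : (Γ - γ) ^ p * Y ≤ M * Z := by
    refine hMest (Γ - γ) X Y Z (by linarith) (by linarith) hY0 hZ0 fun δ hδ hδ1 => ?_
    have e1 := hE1 δ hδ hδ1
    have e2 := hE2 δ hδ
    have hg := hgap γ hγ.le hγΓ.le
    set S := δ * X + δ ^ (1 - p) * Z with hS
    have hS0 : 0 ≤ S := by positivity
    have b1 : (p - 1) * ((γ + 1) * (k + 1) + (k + 1) ^ 2) * S ≤ K₁ * S := by
      gcongr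
      rw [hK₁]
      have : (p - 1) * ((γ + 1) * (k + 1) + (k + 1) ^ 2) ≤
        p * ((Γ + 1) * (k + 1) + (k + 1) ^ 2) := by gcongr ; linarith
      have : (0 : ℝ) ≤ 2 * (k + 1) := by positivity
      linarith
    have b2 : 2 * ((k : ℝ) + 1) * S ≤ K₁ * S := by
      gcongr
      rw [hK₁]
      have : 0 ≤ p * ((Γ + 1) * (k + 1) + (k + 1) ^ 2) := by positivity
      linarith
    have f1 : σ * Y ≤ (p - 1) * (γ + 1) ^ 2 / 4 * X + K₁ * S := by
      refine e1.trans ((le_of_eq ?_).trans (add_le_add_right b1 _))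
      rw [hS]; ring
    have f2 : γ * X ≤ Y + K₁ * S := by
      refine le_trans ?_ (add_le_add_right b2 _)
      rw [hS]; linarith
    refine ⟨?_, ?_⟩
    · have hcε : 0 ≤ c * (Γ - γ) := mul_nonneg hc0.le (by linarith)
      have g1 := mul_le_mul_of_nonneg_left f1 (by linarith : 0 ≤ γ)
      have g2 := mul_le_mul_of_nonneg_left f2
        (by have : 0 ≤ p - 1 := by linarith
            positivity : 0 ≤ (p - 1) * (γ + 1) ^ 2 / 4)
      have g3 := mul_le_mul_of_nonneg_right hg hY0
      have g4 : ((p - 1) * (γ + 1) ^ 2 / 4 + γ) * (K₁ * S) ≤ (σ * Γ + Γ) * (K₁ * S) := by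
        gcongr
        have : σ * γ ≤ σ * Γ := by gcongr
        linarith
      rw [hK₂]
      linarith
    · have : 1 * X ≤ γ * X := by gcongr
      linarith
  have hε : 0 < Γ - γ := by linarith
  set a := p * (σ + γ) / (σ - p + 1) with ha
  set s := (γ + p - 1) / (σ + γ) with hs
  set ν := ((Γ - γ) / (2 * M)) ^ a with hν
  have hν0 : 0 < ν := by positivity
  have h1s : (σ - p + 1) / (σ + γ) = 1 - s := by
    have : 0 < σ + γ := by linarith
    rw [hs]; field_simp; ring
  have hZle : Z ≤ ν ^ (1 - s) * Y + ν ^ (-s) * W := by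
    rw [hZ, hY, hW, ← integral_const_mul, ← integral_const_mul,
      ← integral_add (hA.const_mul _) (hWint.const_mul _)]
    refine integral_mono_ae hQ ((hA.const_mul _).add (hWint.const_mul _)) ?_
    filter_upwards [hVpos] with x hx
    have := weight_young hp hσ hγ hαk hx (abs_nonneg (u x)) (hη0 x) (hη1 x)
      (norm_nonneg (gradient η x)) hν0
    rwa [h1s] at this
  have hν1 : 2 * M * ν ^ (1 - s) ≤ (Γ - γ) ^ p := by
    have e1 : ν ^ (1 - s) = ((Γ - γ) / (2 * M)) ^ p := by
      rw [hν, ← Real.rpow_mul (by positivity), ← h1s]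
      congr 1
      have : 0 < σ + γ := by linarith
      rw [ha]; field_simp
    rw [e1, Real.div_rpow hε.le (by positivity), mul_div_assoc', div_le_iff₀ (by positivity),
      mul_comm]
    gcongr
    exact Real.self_le_rpow_of_one_le (by linarith) (by linarith)
  have hfin : Y ≤ ν⁻¹ * W := by
    have i1 : 2 * M * ν ^ (1 - s) * Y ≤ 2 * M * (ν ^ (-s) * W) := by
      have := mul_le_mul_of_nonneg_right hν1 hY0
      have := mul_le_mul_of_nonneg_left hZle (by linarith : 0 ≤ M)
      linarith
    have i2 : ν ^ (1 - s) * Y ≤ ν ^ (-s) * W := by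
      refine le_of_mul_le_mul_left ?_ (by positivity : 0 < 2 * M)
      linarith
    have i3 : ν ^ (1 - s) = ν * ν ^ (-s) := by
      rw [mul_comm, ← Real.rpow_add_one hν0.ne']; ring_nf
    rw [i3] at i2
    rw [inv_mul_eq_div, le_div_iff₀ hν0]
    refine le_of_mul_le_mul_left ?_ (by positivity : 0 < ν ^ (-s))
    linarith
  refine hfin.trans (le_of_eq ?_)
  rw [hν, ← Real.inv_rpow (by positivity), inv_div]

lemma norm_gradient_eq_norm_fderiv (f : Em m → ℝ) (x : Em m) :
    ‖gradient f x‖ = ‖fderiv ℝ f x‖ := by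
  rw [gradient, LinearIsometryEquiv.norm_map]

lemma exists_deriv_smoothTransition_le :
    ∃ K : ℝ, 1 ≤ K ∧ ∀ t, |deriv Real.smoothTransition t| ≤ K := by
  have hcont : Continuous (deriv Real.smoothTransition) :=
    (Real.smoothTransition.contDiff (n := 1)).continuous_deriv le_rfl
  obtain ⟨K, hK⟩ := (isCompact_Icc (a := (0 : ℝ)) (b := 1)).exists_bound_of_continuousOn
    hcont.continuousOn
  refine ⟨max 1 K, le_max_left _ _, fun t => ?_⟩
  by_cases ht : t ∈ Icc (0 : ℝ) 1
  · exact (hK t ht).trans (le_max_right _ _)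
  · have h0 : deriv Real.smoothTransition t = 0 := by
      rcases lt_or_ge t 0 with h | h
      · have : Real.smoothTransition =ᶠ[nhds t] fun _ => 0 := by
          filter_upwards [Iio_mem_nhds h] with y hy
          exact Real.smoothTransition.zero_of_nonpos (le_of_lt hy)
        rw [this.deriv_eq, deriv_const]
      · have h1 : 1 < t := by
          by_contra h'
          exact ht ⟨h, not_lt.1 h'⟩
        have : Real.smoothTransition =ᶠ[nhds t] fun _ => 1 := by
          filter_upwards [Ioi_mem_nhds h1] with y hy
          exact Real.smoothTransition.one_of_one_le (le_of_lt hy)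
        rw [this.deriv_eq, deriv_const]
    rw [h0, abs_zero]
    exact zero_le_one.trans (le_max_left _ _)

/-- Logarithmic cutoff functions between the radii `R / 2` and `R ^ 2`. -/
lemma exists_log_cutoff (m : ℕ) :
    ∃ K : ℝ, 1 ≤ K ∧ ∀ R : ℝ, 2 ≤ R → ∃ η : Em m → ℝ, ContDiff ℝ 1 η ∧ HasCompactSupport η ∧
      (∀ x, 0 ≤ η x) ∧ (∀ x, η x ≤ 1) ∧ (∀ x, ‖x‖ < R / 2 → η x = 1) ∧
      (∀ x, ‖x‖ < R / 2 → gradient η x = 0) ∧ (∀ x, R ^ 2 < ‖x‖ → gradient η x = 0) ∧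
      ∀ x, 0 < ‖x‖ → ‖gradient η x‖ ≤ K / (Real.log R * ‖x‖) := by
  obtain ⟨K, hK, hKb⟩ := exists_deriv_smoothTransition_le
  refine ⟨K, hK, fun R hR => ?_⟩
  have hL : 0 < Real.log R := Real.log_pos (by linarith)
  set L := Real.log R with hLdef
  set f : Em m → ℝ := fun x => 2 - Real.log (1 + ‖x‖ ^ 2) / (2 * L) with hf
  have hpos (x : Em m) : 0 < 1 + ‖x‖ ^ 2 := by positivity
  have hfC : ContDiff ℝ 1 f := by
    refine contDiff_const.sub (ContDiff.div_const (ContDiff.log ?_ fun x => (hpos x).ne') _)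
    exact contDiff_const.add (contDiff_norm_sq ℝ)
  have hone (x : Em m) (hx : ‖x‖ < R / 2) : Real.smoothTransition (f x) = 1 := by
    apply Real.smoothTransition.one_of_one_le
    have h1 : Real.log (1 + ‖x‖ ^ 2) ≤ 2 * L := by
      have : 2 * L = Real.log (R ^ 2) := by rw [Real.log_pow]; push_cast; ring
      rw [this]
      apply Real.log_le_log (hpos x)
      have : ‖x‖ ^ 2 ≤ (R / 2) ^ 2 := by gcongr
      nlinarith
    have : Real.log (1 + ‖x‖ ^ 2) / (2 * L) ≤ 1 := by rwa [div_le_one (by positivity)]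
    simp only [hf]; linarith
  have hzero (x : Em m) (hx : R ^ 2 < ‖x‖) : Real.smoothTransition (f x) = 0 := by
    apply Real.smoothTransition.zero_of_nonpos
    have h1 : 2 * (2 * L) ≤ Real.log (1 + ‖x‖ ^ 2) := by
      have : 2 * (2 * L) = Real.log ((R ^ 2) ^ 2) := by
        rw [Real.log_pow, Real.log_pow]; push_cast; ring
      rw [this]
      apply Real.log_le_log (by positivity)
      have : (R ^ 2) ^ 2 ≤ ‖x‖ ^ 2 := by gcongr
      linarith
    have : 2 ≤ Real.log (1 + ‖x‖ ^ 2) / (2 * L) := by rwa [le_div_iff₀ (by positivity)]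
    simp only [hf]; linarith
  refine ⟨fun x => Real.smoothTransition (f x), Real.smoothTransition.contDiff.comp hfC, ?_,
    fun x => Real.smoothTransition.nonneg _, fun x => Real.smoothTransition.le_one _, hone, ?_, ?_,
    ?_⟩
  · refine HasCompactSupport.intro (isCompact_closedBall (0 : Em m) (R ^ 2)) fun x hx => ?_
    apply hzero
    simpa using hx
  · intro x hx
    have : (fun x => Real.smoothTransition (f x)) =ᶠ[nhds x] fun _ => 1 := by
      filter_upwards [(isOpen_lt continuous_norm continuous_const).mem_nhds hx] with y hy
      exact hone y hy
    rw [this.gradient_eq, gradient_fun_const]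
  · intro x hx
    have : (fun x => Real.smoothTransition (f x)) =ᶠ[nhds x] fun _ => 0 := by
      filter_upwards [(isOpen_lt continuous_const continuous_norm).mem_nhds hx] with y hy
      exact hzero y hy
    rw [this.gradient_eq, gradient_fun_const]
  · intro x hx
    have d1 : HasFDerivAt (fun x : Em m => 1 + ‖x‖ ^ 2) ((2 : ℝ) • innerSL ℝ x) x := by
      have := (hasStrictFDerivAt_norm_sq x).hasFDerivAt.const_add (1 : ℝ)
      refine this.congr_fderiv ?_
      ext y
      simp
    have d2 : HasFDerivAt f _ x :=
      (((d1.log (hpos x).ne').mul_const (2 * L)⁻¹).const_sub 2)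
    have d3 := ((Real.smoothTransition.contDiff (n := 1)).differentiable one_ne_zero
      (f x)).hasDerivAt.comp_hasFDerivAt x d2
    have d4 : HasFDerivAt (fun x => Real.smoothTransition (f x)) _ x := d3
    rw [norm_gradient_eq_norm_fderiv, d4.fderiv]
    simp only [norm_smul, norm_neg, innerSL_apply_norm, Real.norm_eq_abs]
    rw [abs_of_pos (inv_pos.2 (hpos x)), abs_of_pos (by positivity : 0 < (2 * L)⁻¹),
      abs_of_pos (by norm_num : (0 : ℝ) < 2)]
    have h1 : (2 * L)⁻¹ * ((1 + ‖x‖ ^ 2)⁻¹ * (2 * ‖x‖)) ≤ 1 / (L * ‖x‖) := by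
      rw [le_div_iff₀ (by positivity)]
      field_simp
      nlinarith
    calc _ ≤ K * (1 / (L * ‖x‖)) := by gcongr; exact hKb _
      _ = _ := by ring

lemma exists_dyadic_annulus {R L r : ℝ} (hR : 0 < R) (hRL : R = Real.exp L) (hL : 1 ≤ L)
    (h1 : R / 2 ≤ r) (h2 : r ≤ R ^ 2) :
    ∃ j < ⌈2 * L⌉₊ + 1, R * 2 ^ j / 2 ≤ r ∧ r < R * 2 ^ j := by
  have hex : r < R * 2 ^ ⌈2 * L⌉₊ := by
    have e1 : Real.exp L < 2 ^ ⌈2 * L⌉₊ := by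
      have : (2 : ℝ) ^ ⌈2 * L⌉₊ = Real.exp (⌈2 * L⌉₊ * Real.log 2) := by
        rw [Real.exp_nat_mul, Real.exp_log (by norm_num)]
      rw [this, Real.exp_lt_exp]
      have h3 := Nat.le_ceil (2 * L)
      have h4 := Real.log_two_gt_d9
      nlinarith
    calc r ≤ R * R := by rw [← sq]; exact h2
      _ < _ := by gcongr; rwa [hRL]
  classical
  have hP : ∃ j, r < R * 2 ^ j := ⟨_, hex⟩
  refine ⟨Nat.find hP, Nat.lt_succ_of_le (Nat.find_min' hP hex), ?_, Nat.find_spec hP⟩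
  rcases Nat.eq_zero_or_pos (Nat.find hP) with h0 | h0
  · rw [h0]; simpa using h1
  · obtain ⟨i, hi⟩ := Nat.exists_eq_succ_of_ne_zero h0.ne'
    have := Nat.find_min hP (m := i) (by omega)
    rw [hi, pow_succ]
    linarith [not_lt.1 this]

/-- On each dyadic annulus, the decay of the cutoff compensates the growth of the weight. -/
lemma dyadic_term_le {α p C₀ C K L b ρ a : ℝ} (hp : 0 < p) (hC₀ : 0 < C₀) (hC : 0 < C)
    (hK : 1 ≤ K) (hL : 1 ≤ L) (hb : b < 0) (hρ : Real.exp L ≤ ρ) (hρ' : ρ ≤ Real.exp (5 * L))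
    (ha : a = α - p * L⁻¹) :
    (2 * K / (L * ρ)) ^ a * (C * ρ ^ (α + C₀ * L⁻¹) * Real.log ρ ^ b) ≤
      C * Real.exp (5 * (p + C₀)) * (2 * K / L) ^ a * L ^ b := by
  have hρ0 : 0 < ρ := (Real.exp_pos _).trans_le hρ
  have hL0 : 0 < L := by linarith
  have h1 : Real.log ρ ^ b ≤ L ^ b := by
    apply Real.rpow_le_rpow_of_nonpos hL0 _ hb.le
    rw [Real.le_log_iff_exp_le hρ0]; exact hρ
  have h2 : ρ ^ ((p + C₀) * L⁻¹) ≤ Real.exp (5 * (p + C₀)) := by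
    calc ρ ^ ((p + C₀) * L⁻¹) ≤ Real.exp (5 * L) ^ ((p + C₀) * L⁻¹) := by gcongr
      _ = _ := by
        rw [← Real.exp_mul]; congr 1; field_simp
  have h3 : (2 * K / (L * ρ)) ^ a * ρ ^ (α + C₀ * L⁻¹) =
      (2 * K / L) ^ a * ρ ^ ((p + C₀) * L⁻¹) := by
    rw [← div_div, Real.div_rpow (by positivity) hρ0.le, div_mul_eq_mul_div, mul_div_assoc,
      ← Real.rpow_sub hρ0]
    congr 2
    rw [ha]; ring
  calc _ = C * ((2 * K / (L * ρ)) ^ a * ρ ^ (α + C₀ * L⁻¹)) * Real.log ρ ^ b := by ring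
    _ = C * ((2 * K / L) ^ a * ρ ^ ((p + C₀) * L⁻¹)) * Real.log ρ ^ b := by rw [h3]
    _ ≤ C * ((2 * K / L) ^ a * Real.exp (5 * (p + C₀))) * L ^ b := by
      have : 0 ≤ Real.log ρ ^ b := by
        apply Real.rpow_nonneg
        apply Real.log_nonneg
        linarith [Real.add_one_le_exp L]
      gcongr
    _ = _ := by ring

lemma lintegral_weight_le {V η : Em m → ℝ} {α β p C C₀ R₀ ε₀ b K R L a : ℝ} (hp : 0 < p)
    (hC : 0 < C) (hC₀ : 0 < C₀) (hb : b < 0)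
    (hvol : ∀ ε ∈ Set.Ioo (0 : ℝ) ε₀, ∀ R > R₀,
      (∫⁻ x in Metric.ball (0 : Em m) R \ Metric.ball (0 : Em m) (R / 2),
          ENNReal.ofReal (V x ^ (-β + ε))) ≤
        ENNReal.ofReal (C * R ^ (α + C₀ * ε) * Real.log R ^ b))
    (hK : 1 ≤ K) (hL : 1 ≤ L) (hLε : L⁻¹ < ε₀) (hR : R = Real.exp L) (hRR₀ : R₀ < R)
    (ha : a = α - p * L⁻¹) (ha0 : 0 < a)
    (hη1 : ∀ x, ‖x‖ < R / 2 → gradient η x = 0) (hη2 : ∀ x, R ^ 2 < ‖x‖ → gradient η x = 0)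
    (hη3 : ∀ x, 0 < ‖x‖ → ‖gradient η x‖ ≤ K / (L * ‖x‖)) :
    ∫⁻ x, ENNReal.ofReal (V x ^ (-β + L⁻¹) * ‖gradient η x‖ ^ a) ≤
      ENNReal.ofReal (4 * L * (C * Real.exp (5 * (p + C₀)) * (2 * K / L) ^ a * L ^ b)) := by
  have hL0 : 0 < L := by linarith
  have hR0 : 0 < R := hR ▸ Real.exp_pos L
  set N := ⌈2 * L⌉₊ + 1 with hN
  have hN4 : (N : ℝ) ≤ 4 * L := by
    have := Nat.ceil_lt_add_one (by positivity : 0 ≤ 2 * L)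
    rw [hN]; push_cast; linarith
  set A : Fin N → Set (Em m) := fun j =>
    Metric.ball (0 : Em m) (R * 2 ^ (j : ℕ)) \ Metric.ball (0 : Em m) (R * 2 ^ (j : ℕ) / 2) with hA
  set T := C * Real.exp (5 * (p + C₀)) * (2 * K / L) ^ a * L ^ b with hT
  have hsupp : Function.support (fun x => ENNReal.ofReal (V x ^ (-β + L⁻¹) * ‖gradient η x‖ ^ a)) ⊆
      ⋃ j, A j := by
    intro x hx
    have hg : gradient η x ≠ 0 := by
      intro h
      apply hx
      simp [h, Real.zero_rpow ha0.ne']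
    have h1 : R / 2 ≤ ‖x‖ := not_lt.1 fun h => hg (hη1 x h)
    have h2 : ‖x‖ ≤ R ^ 2 := not_lt.1 fun h => hg (hη2 x h)
    obtain ⟨j, hj, h3, h4⟩ := exists_dyadic_annulus hR0 hR hL h1 h2
    refine mem_iUnion.2 ⟨⟨j, hj⟩, ?_, ?_⟩
    · simpa using h4
    · simpa using h3
  rw [← setLIntegral_eq_of_support_subset hsupp]
  refine (lintegral_iUnion_le A _).trans ?_
  rw [tsum_fintype]
  have hterm (j : Fin N) :
      ∫⁻ x in A j, ENNReal.ofReal (V x ^ (-β + L⁻¹) * ‖gradient η x‖ ^ a) ≤ ENNReal.ofReal T := by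
    set ρ := R * 2 ^ (j : ℕ) with hρ
    have hρ0 : 0 < ρ := by positivity
    have hRρ : R ≤ ρ := le_mul_of_one_le_right hR0.le (one_le_pow₀ (by norm_num))
    have hρL : ρ ≤ Real.exp (5 * L) := by
      have e1 : (2 : ℝ) ^ (j : ℕ) ≤ Real.exp (4 * L) := by
        have : (2 : ℝ) ^ (j : ℕ) ≤ Real.exp 1 ^ (j : ℕ) := by
          gcongr; linarith [Real.add_one_le_exp 1]
        refine this.trans ?_
        rw [← Real.exp_nat_mul, Real.exp_le_exp, mul_one]
        exact (Nat.cast_le.2 j.2.le).trans hN4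
      calc ρ ≤ Real.exp L * Real.exp (4 * L) := by rw [hρ, ← hR]; gcongr
        _ = _ := by rw [← Real.exp_add]; ring_nf
    have hmeas : MeasurableSet (A j) := measurableSet_ball.diff measurableSet_ball
    calc _ ≤ ∫⁻ x in A j, ENNReal.ofReal ((2 * K / (L * ρ)) ^ a) *
            ENNReal.ofReal (V x ^ (-β + L⁻¹)) := by
          refine setLIntegral_mono_ae' hmeas (Eventually.of_forall fun x hx => ?_)
          have hxρ : ρ / 2 ≤ ‖x‖ := by simpa using hx.2
          have hx0 : 0 < ‖x‖ := lt_of_lt_of_le (by positivity) hxρ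
          have hg : ‖gradient η x‖ ≤ 2 * K / (L * ρ) := by
            refine (hη3 x hx0).trans ?_
            calc K / (L * ‖x‖) ≤ K / (L * (ρ / 2)) := by gcongr
              _ = _ := by field_simp
          rw [mul_comm, ENNReal.ofReal_mul (by positivity)]
          gcongr
      _ = ENNReal.ofReal ((2 * K / (L * ρ)) ^ a) *
            ∫⁻ x in A j, ENNReal.ofReal (V x ^ (-β + L⁻¹)) :=
          lintegral_const_mul' _ _ ENNReal.ofReal_ne_top
      _ ≤ ENNReal.ofReal ((2 * K / (L * ρ)) ^ a) *
            ENNReal.ofReal (C * ρ ^ (α + C₀ * L⁻¹) * Real.log ρ ^ b) := by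
          gcongr
          exact hvol L⁻¹ ⟨inv_pos.2 hL0, hLε⟩ ρ (lt_of_lt_of_le hRR₀ hRρ)
      _ ≤ ENNReal.ofReal T := by
          rw [← ENNReal.ofReal_mul (by positivity)]
          exact ENNReal.ofReal_le_ofReal
            (dyadic_term_le hp hC₀ hC hK hL hb (hR ▸ hRρ) hρL ha)
  have hT0 : 0 ≤ T := by positivity
  calc _ ≤ ∑ _j : Fin N, ENNReal.ofReal T := Finset.sum_le_sum fun j _ => hterm j
    _ = ENNReal.ofReal (N * T) := by
      rw [Finset.sum_const, Finset.card_univ, Fintype.card_fin, nsmul_eq_mul,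
        ENNReal.ofReal_mul (p := (N : ℝ)) (by positivity), ENNReal.ofReal_natCast]
    _ ≤ _ := ENNReal.ofReal_le_ofReal (by gcongr)

lemma integrable_of_lintegral_ofReal_le {X : Type*} [MeasurableSpace X] {μ : Measure X}
    {f : X → ℝ} {B : ℝ} (hf : AEStronglyMeasurable f μ) (h0 : 0 ≤ᵐ[μ] f) (hB : 0 ≤ B)
    (h : ∫⁻ x, ENNReal.ofReal (f x) ∂μ ≤ ENNReal.ofReal B) :
    Integrable f μ ∧ ∫ x, f x ∂μ ≤ B := by
  refine ⟨⟨hf, ?_⟩, ?_⟩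
  · rw [hasFiniteIntegral_iff_ofReal h0]
    exact h.trans_lt ENNReal.ofReal_lt_top
  · rw [integral_eq_lintegral_of_nonneg_ae h0 hf]
    exact ENNReal.toReal_le_of_le_ofReal hB h

/-- The weighted energy below the critical exponent decays along logarithmic cutoffs. -/
lemma exists_energy_decay {V u : Em m → ℝ} {p σ C C₀ R₀ ε₀ b : ℝ} (hp : 2 ≤ p) (hσ : p - 1 < σ)
    (hVloc : LocallyIntegrable V volume) (hVpos : ∀ᵐ x : Em m, 0 < V x)
    (hC : 0 < C) (hC₀ : 0 < C₀) (hε₀ : 0 < ε₀) (hb : b < 0)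
    (hvol : ∀ ε ∈ Set.Ioo (0 : ℝ) ε₀, ∀ R > R₀,
      (∫⁻ x in Metric.ball (0 : Em m) R \ Metric.ball (0 : Em m) (R / 2),
          ENNReal.ofReal (V x ^ (-(betaC p σ) + ε))) ≤
        ENNReal.ofReal (C * R ^ (alphaC p σ + C₀ * ε) * Real.log R ^ b))
    (hu : IsWeakSol p σ V u) (hst : IsStable p σ V u) :
    ∃ T : ℝ, ∀ᶠ L : ℝ in atTop, ∀ ρ ≤ Real.exp L / 2,
      ∫ x in ball (0 : Em m) ρ, V x * |u x| ^ (σ + (gammaBar p σ - (σ - p + 1) * L⁻¹)) ≤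
        T * L ^ (b + 1) := by
  obtain ⟨k, hk⟩ : ∃ k : ℕ, alphaC p σ ≤ 2 * ((k : ℝ) + 1) := by
    obtain ⟨k, hk⟩ := exists_nat_ge (alphaC p σ)
    exact ⟨k, by linarith [(Nat.cast_nonneg k : (0 : ℝ) ≤ k)]⟩
  obtain ⟨M, hM, hap⟩ := exists_apriori_constant hp hσ hVloc hVpos hu hst hk
  obtain ⟨K, hK, hcut⟩ := exists_log_cutoff m
  have hΓ := one_lt_gammaBar hp hσ
  have hq : 0 < σ - p + 1 := by linarith
  have hαdef : alphaC p σ = p * (σ + gammaBar p σ) / (σ - p + 1) := rfl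
  have hβdef : betaC p σ = (gammaBar p σ + p - 1) / (σ - p + 1) := rfl
  set Γ := gammaBar p σ
  set q := σ - p + 1 with hqdef
  refine ⟨max 1 (2 * K * M / q) ^ alphaC p σ * (4 * C * Real.exp (5 * (p + C₀))), ?_⟩
  have hinv := tendsto_inv_atTop_zero (𝕜 := ℝ)
  have hqinv : Tendsto (fun L : ℝ => q * L⁻¹) atTop (nhds 0) := by simpa using hinv.const_mul q
  filter_upwards [eventually_ge_atTop 1, hinv.eventually_lt_const hε₀,
    hqinv.eventually_lt_const (sub_pos.2 hΓ), Real.tendsto_exp_atTop.eventually_gt_atTop R₀]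
    with L hL hLε hLΓ hLR ρ hρ
  have hL0 : 0 < L := by linarith
  have hLi : 0 < L⁻¹ := inv_pos.2 hL0
  set γ := Γ - q * L⁻¹ with hγ
  have hγ1 : 1 < γ := by linarith
  have hγΓ : γ < Γ := by rw [hγ]; linarith [mul_pos hq hLi]
  obtain ⟨η, hη, hηs, hη0, hη1, hηone, hg1, hg2, hg3⟩ :=
    hcut (Real.exp L) (by linarith [Real.add_one_le_exp L])
  rw [Real.log_exp] at hg3
  set a := p * (σ + γ) / q with ha
  have haα : a = alphaC p σ - p * L⁻¹ := by rw [ha, hαdef, hγ]; field_simp; ring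
  have ha0 : 0 < a := by
    have : 0 < σ + γ := by linarith
    positivity
  have hβ : -((γ + p - 1) / q) = -betaC p σ + L⁻¹ := by
    rw [hβdef, hγ]; field_simp; ring
  have hw := lintegral_weight_le (by linarith : 0 < p) hC hC₀ hb hvol hK hL hLε rfl hLR haα ha0
    hg1 hg2 hg3
  rw [← hβ] at hw
  obtain ⟨hWint, hW⟩ := integrable_of_lintegral_ofReal_le
    (f := fun x => V x ^ (-((γ + p - 1) / q)) * ‖gradient η x‖ ^ a)
    (((hVloc.aestronglyMeasurable.aemeasurable.pow_const _).aestronglyMeasurable).mul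
      ((continuous_gradient hη).norm.rpow_const fun _ => Or.inr ha0.le).aestronglyMeasurable)
    (hVpos.mono fun x hx => mul_nonneg (Real.rpow_nonneg hx.le _) (by positivity))
    (by positivity) hw
  have hmain := hap γ hγ1 hγΓ η hη hηs hη0 hη1 hWint
  have hσγ : 0 < σ + γ := by linarith
  have hloc : ∫ x in ball (0 : Em m) ρ, V x * |u x| ^ (σ + γ) ≤
      ∫ x, V x * |u x| ^ (σ + γ) * η x ^ (2 * ((k : ℝ) + 1)) := by
    have h_int := integrable_potential_energy hVloc hu.1 hη hηs (r := σ + γ)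
      (n := 2 * ((k : ℝ) + 1)) hσγ (by positivity)
    calc _ = ∫ x in ball (0 : Em m) ρ, V x * |u x| ^ (σ + γ) * η x ^ (2 * ((k : ℝ) + 1)) := by
          refine setIntegral_congr_fun measurableSet_ball fun x hx => ?_
          have hx' : ‖x‖ < Real.exp L / 2 := lt_of_lt_of_le (by simpa using hx) hρ
          simp [hηone x hx']
      _ ≤ _ := setIntegral_le_integral h_int (hVpos.mono fun x hx =>
          mul_nonneg (mul_nonneg hx.le (by positivity)) (Real.rpow_nonneg (hη0 x) _))
  refine hloc.trans (hmain.trans ?_)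
  have hgap : Γ - γ = q / L := by rw [hγ]; field_simp; ring
  have hprod : (M / (Γ - γ)) ^ a * (2 * K / L) ^ a = (2 * K * M / q) ^ a := by
    rw [hgap, ← Real.mul_rpow (by positivity) (by positivity)]
    congr 1
    field_simp
  have hbase : (2 * K * M / q) ^ a ≤ max 1 (2 * K * M / q) ^ alphaC p σ := by
    calc (2 * K * M / q) ^ a ≤ max 1 (2 * K * M / q) ^ a :=
          Real.rpow_le_rpow (by positivity) (le_max_right _ _) ha0.le
      _ ≤ _ := by
          refine Real.rpow_le_rpow_of_exponent_le (le_max_left _ _) ?_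
          rw [haα]
          have : 0 < p * L⁻¹ := by positivity
          linarith
  have hMg : 0 ≤ (M / (Γ - γ)) ^ a := by rw [hgap]; positivity
  calc _ ≤ (M / (Γ - γ)) ^ a *
        (4 * L * (C * Real.exp (5 * (p + C₀)) * (2 * K / L) ^ a * L ^ b)) := by gcongr
    _ = ((M / (Γ - γ)) ^ a * (2 * K / L) ^ a) * (4 * C * Real.exp (5 * (p + C₀))) *
        (L ^ b * L) := by ring
    _ = (2 * K * M / q) ^ a * (4 * C * Real.exp (5 * (p + C₀))) * L ^ (b + 1) := by
        rw [hprod, Real.rpow_add_one hL0.ne']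
    _ ≤ _ := by gcongr

end

theorem nonexistence_stable_log_power (m : ℕ) (hm : 1 ≤ m) (p σ : ℝ) (hp : 2 ≤ p) (hσ : p - 1 < σ)
    (V : Em m → ℝ) (hVloc : LocallyIntegrable V volume)
    (hVpos : ∀ᵐ x : Em m, 0 < V x)
    (C C₀ R₀ ε₀ b : ℝ) (hC : 0 < C) (hC₀ : 0 < C₀) (hR₀ : 0 < R₀) (hε₀ : 0 < ε₀)
    (hb : b < -1)
    (hvol : ∀ ε ∈ Set.Ioo (0 : ℝ) ε₀, ∀ R > R₀,
      (∫⁻ x in Metric.ball (0 : Em m) R \ Metric.ball (0 : Em m) (R / 2),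
          ENNReal.ofReal (V x ^ (-(betaC p σ) + ε))) ≤
        ENNReal.ofReal (C * R ^ (alphaC p σ + C₀ * ε) * Real.log R ^ b))
    (u : Em m → ℝ) (hu : IsWeakSol p σ V u) (hst : IsStable p σ V u) :
    ∀ᵐ x : Em m, u x = 0 := by
  obtain ⟨T, hT⟩ := exists_energy_decay hp hσ hVloc hVpos hC hC₀ hε₀ (by linarith) hvol hu hst
  have hΓ := one_lt_gammaBar hp hσ
  set Γ := gammaBar p σ
  have hσΓ : 0 < σ + Γ := by linarith
  have hq : 0 < σ - p + 1 := by linarith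
  have h_int {r : ℝ} (hr : 0 < r) (ρ : ℝ) :
      IntegrableOn (fun x => V x * |u x| ^ r) (ball (0 : Em m) ρ) :=
    ((hVloc.integrableOn_isCompact (isCompact_closedBall 0 ρ)).mul_continuousOn
      (hu.1.continuous.abs.rpow_const fun _ => Or.inr hr.le).continuousOn
      (isCompact_closedBall 0 ρ)).mono_set ball_subset_closedBall
  have hball (ρ : ℝ) : ∀ᵐ x : Em m, x ∈ ball (0 : Em m) ρ → u x = 0 := by
    obtain ⟨S, hS⟩ := (isCompact_closedBall (0 : Em m) ρ).exists_bound_of_continuousOn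
      hu.1.continuous.continuousOn
    have hnonneg : 0 ≤ᵐ[volume.restrict (ball (0 : Em m) ρ)] fun x => V x * |u x| ^ (σ + Γ) :=
      ae_restrict_of_ae (hVpos.mono fun x hx => mul_nonneg hx.le (by positivity))
    have hqinv : Tendsto (fun L : ℝ => (σ - p + 1) * L⁻¹) atTop (nhds 0) := by
      simpa using (tendsto_inv_atTop_zero (𝕜 := ℝ)).const_mul (σ - p + 1)
    have hev : ∀ᶠ L : ℝ in atTop, ∫ x in ball (0 : Em m) ρ, V x * |u x| ^ (σ + Γ) ≤
        max 1 S * (T * L ^ (b + 1)) := by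
      filter_upwards [hT, eventually_gt_atTop 0, hqinv.eventually_lt_const one_pos,
        Real.tendsto_exp_atTop.eventually_ge_atTop (2 * ρ)] with L hTL hL hL1 hLρ
      refine le_trans ?_ (mul_le_mul_of_nonneg_left (hTL ρ (by linarith)) (by positivity))
      have hδ : 0 < (σ - p + 1) * L⁻¹ := by positivity
      set δ := (σ - p + 1) * L⁻¹
      rw [← integral_const_mul]
      refine setIntegral_mono_on_ae (h_int hσΓ ρ) ((h_int (by linarith) ρ).const_mul _)
        measurableSet_ball ?_
      filter_upwards [hVpos] with x hx hxρ
      have hux : |u x| ≤ max 1 S := (hS x (ball_subset_closedBall hxρ)).trans (le_max_right _ _)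
      have hpow : |u x| ^ δ ≤ max 1 S :=
        calc |u x| ^ δ ≤ max 1 S ^ δ := by gcongr
          _ ≤ max 1 S ^ (1 : ℝ) := Real.rpow_le_rpow_of_exponent_le (le_max_left _ _) hL1.le
          _ = _ := Real.rpow_one _
      have hsplit : |u x| ^ (σ + Γ) = |u x| ^ δ * |u x| ^ (σ + (Γ - δ)) := by
        rw [← Real.rpow_add_of_nonneg (abs_nonneg _) hδ.le (by linarith)]
        congr 1; ring
      rw [hsplit]
      calc _ ≤ V x * (max 1 S * |u x| ^ (σ + (Γ - δ))) := by gcongr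
        _ = _ := by ring
    have hlim : Tendsto (fun L : ℝ => max 1 S * (T * L ^ (b + 1))) atTop (nhds 0) := by
      have := tendsto_rpow_neg_atTop (y := -(b + 1)) (by linarith)
      simpa using (this.const_mul T).const_mul (max 1 S)
    have hzero := le_antisymm (ge_of_tendsto hlim hev) (integral_nonneg_of_ae hnonneg)
    rw [integral_eq_zero_iff_of_nonneg_ae hnonneg (h_int hσΓ ρ)] at hzero
    have hzero' := (ae_restrict_iff' measurableSet_ball).1 hzero
    filter_upwards [hzero', hVpos] with x hx hVx hxρ
    have := (mul_eq_zero.1 (hx hxρ)).resolve_left hVx.ne'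
    exact abs_eq_zero.1 ((Real.rpow_eq_zero (abs_nonneg _) hσΓ.ne').1 this)
  filter_upwards [ae_all_iff.2 fun n : ℕ => hball n] with x hx
  obtain ⟨n, hn⟩ := exists_nat_gt ‖x‖
  exact hx n (by simpa using hn)
end
end
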